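/- Let T be a finite tree with at least two vertices, and let f : V(T) → V(T) be a function with f(v) ≠ v for every vertex v. For each vertex v, let s(v) denote the first vertex after v on the unique path in T from v to f(v). Then there exists an edge uv of T such that s(u) = v and s(v) = u. -/

import Mathlib

open SimpleGraph

/-- Let `T` be a finite tree on at least two vertices and `f` a fixed-point-free map on its
vertices.  For each vertex `v`, let `s v` be the first vertex after `v` on the unique path
in `T` from `v` to `f v` (that is, `s v` is a neighbour of `v` with
`d_T(v, f v) = d_T(s v, f v) + 1`).  Then there is an edge `uv` of `T` with `s u = v` and
`s v = u`. -/
theorem exists_mutual_successor_edge {V : Type*} [Fintype V]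
    (T : SimpleGraph V) (hT : T.IsTree) (hcard : 2 ≤ Fintype.card V)
    (f : V → V) (hf : ∀ v, f v ≠ v)
    (s : V → V)
    (hs : ∀ v, T.Adj v (s v) ∧ T.dist v (f v) = T.dist (s v) (f v) + 1) :
    ∃ u v, T.Adj u v ∧ s u = v ∧ s v = u := by
  classical
  have hc := hT.card_edgeFinset
  obtain ⟨u, -, v, -, huv, he⟩ := Finset.exists_ne_map_eq_of_card_lt_of_maps_to
    (s := (Finset.univ : Finset V)) (t := T.edgeFinset) (f := fun v => s(v, s v))
    (by rw [Finset.card_univ]; omega)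
    (by intro v _; simpa using (hs v).1)
  rcases Sym2.eq_iff.1 he with ⟨h, _⟩ | ⟨h1, h2⟩
  · exact absurd h huv
  · exact ⟨u, v, h2 ▸ (hs u).1, h2, h1.symm⟩
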